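/- arXiv:1210.0882 — 2 statements merged into one kernel-verified Lean document; each statement's English description precedes it below -/
import Mathlib

section
/- The Riemann zeta function has no infinite vertical arithmetic progression of zeroes: for every D ∈ (0,1) and every p > 0, there exists a positive integer n such that ζ(D + i n p) ≠ 0. -/
open Complex Filter Topology Finset

/-- The error of the trapezoidal rule for `∫ u ^ (-s)` over `[m, m + 1]`. -/
noncomputable def trapezoidError (m : ℕ) (s : ℂ) : ℂ :=
  ((m : ℂ) ^ (-s) + ((m + 1 : ℕ) : ℂ) ^ (-s)) / 2
    - (((m + 1 : ℕ) : ℂ) ^ (1 - s) - (m : ℂ) ^ (1 - s)) / (1 - s)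

lemma norm_trapezoidError_le {m : ℕ} (hm : 0 < m) {s : ℂ} (hσ : 0 < s.re) (hs : s ≠ 1) :
    ‖trapezoidError m s‖ ≤ ‖s‖ * ‖s + 1‖ * (m : ℝ) ^ (-s.re) / m ^ 2 / 2 := by
  have hm' : (0 : ℝ) < m := by exact_mod_cast hm
  have h1s : 1 - s ≠ 0 := sub_ne_zero.mpr hs.symm
  let H : ℝ → ℂ := fun u ↦ ((u : ℂ) - m) * (u - m - 1) / 2 * (-s * (u : ℂ) ^ (-s - 1))
    - (u - m - 1 / 2) * (u : ℂ) ^ (-s) + (u : ℂ) ^ (1 - s) / (1 - s)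
  have hpow (c : ℂ) {u : ℝ} (hu : 0 < u) :
      HasDerivAt (fun x : ℝ ↦ (x : ℂ) ^ c) (c * (u : ℂ) ^ (c - 1)) u := by
    simpa using ((hasDerivAt_id (u : ℂ)).cpow_const (c := c)
      (Or.inl (by simpa using hu))).comp_ofReal
  have hH : ∀ u ∈ Set.Icc (m : ℝ) (m + 1), HasDerivWithinAt H
      (((u : ℂ) - m) * (u - m - 1) / 2 * (s * (s + 1) * (u : ℂ) ^ (-s - 2)))
      (Set.Icc (m : ℝ) (m + 1)) u := by
    intro u hu
    have hu0 : 0 < u := hm'.trans_le hu.1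
    have hid : HasDerivAt (fun x : ℝ ↦ (x : ℂ)) 1 u := ofRealCLM.hasDerivAt
    have e1 : -s - 1 - 1 = -s - 2 := by ring
    have e2 : 1 - s - 1 = -s := by ring
    have h1 := hpow (-s - 1) hu0
    have h2 := hpow (-s) hu0
    have h3 := hpow (1 - s) hu0
    rw [e1] at h1
    rw [e2] at h3
    have h := (((((hid.sub_const (m : ℂ)).mul ((hid.sub_const (m : ℂ)).sub_const 1)).div_const
      2).mul (h1.const_mul (-s))).sub (((hid.sub_const (m : ℂ)).sub_const (1 / 2)).mul h2)).add
        (h3.div_const (1 - s))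
    refine (h.congr_deriv ?_).hasDerivWithinAt
    simp only [Pi.mul_apply]
    field_simp
    ring
  have hbound : ∀ u ∈ Set.Icc (m : ℝ) (m + 1),
      ‖((u : ℂ) - m) * (u - m - 1) / 2 * (s * (s + 1) * (u : ℂ) ^ (-s - 2))‖ ≤
        ‖s‖ * ‖s + 1‖ * (m : ℝ) ^ (-s.re) / m ^ 2 / 2 := by
    intro u hu
    have hu0 : 0 < u := hm'.trans_le hu.1
    have h1 : ‖(u : ℂ) - m‖ ≤ 1 := by
      rw [← ofReal_natCast, ← ofReal_sub, norm_real, Real.norm_eq_abs, abs_le]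
      constructor <;> linarith [hu.1, hu.2]
    have h2 : ‖(u : ℂ) - m - 1‖ ≤ 1 := by
      rw [← ofReal_natCast, ← ofReal_one, ← ofReal_sub, ← ofReal_sub, norm_real,
        Real.norm_eq_abs, abs_le]
      constructor <;> linarith [hu.1, hu.2]
    have h3 : ‖(u : ℂ) ^ (-s - 2)‖ ≤ (m : ℝ) ^ (-s.re) / m ^ 2 := by
      rw [norm_cpow_eq_rpow_re_of_pos hu0]
      calc u ^ (-s - 2).re ≤ (m : ℝ) ^ (-s - 2).re :=
            Real.rpow_le_rpow_of_nonpos hm' hu.1 (by simp; linarith)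
        _ = _ := by
            rw [show (-s - 2).re = -s.re - (2 : ℕ) by simp, Real.rpow_sub_natCast hm'.ne']
    have h12 : ‖(u : ℂ) - m‖ * ‖(u : ℂ) - m - 1‖ ≤ 1 :=
      mul_le_one₀ h1 (norm_nonneg _) h2
    rw [norm_mul, norm_div, norm_mul, norm_mul, norm_mul, norm_ofNat]
    calc ‖(u : ℂ) - m‖ * ‖(u : ℂ) - m - 1‖ / 2 * (‖s‖ * ‖s + 1‖ * ‖(u : ℂ) ^ (-s - 2)‖)
        ≤ 1 / 2 * (‖s‖ * ‖s + 1‖ * ((m : ℝ) ^ (-s.re) / m ^ 2)) := by gcongr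
      _ = _ := by ring
  have h := norm_image_sub_le_of_norm_deriv_le_segment' hH
    (fun u hu ↦ hbound u (Set.Ico_subset_Icc_self hu)) (m + 1) (by simp)
  have hval : H (m + 1) - H m = -trapezoidError m s := by
    simp only [H, trapezoidError]
    push_cast
    field_simp
    ring
  rw [hval, norm_neg] at h
  linarith

lemma differentiableOn_trapezoidError {m : ℕ} (hm : 0 < m) :
    DifferentiableOn ℂ (trapezoidError m) {1}ᶜ := by
  intro s hs
  have hs' : 1 - s ≠ 0 := sub_ne_zero.mpr (Ne.symm hs)
  have hm1 : (m : ℂ) ≠ 0 := by exact_mod_cast hm.ne'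
  have hm2 : ((m + 1 : ℕ) : ℂ) ≠ 0 := by exact_mod_cast m.succ_ne_zero
  have hc (c : ℂ) (hc : c ≠ 0) : DifferentiableAt ℂ (fun z ↦ c ^ (-z)) s :=
    differentiableAt_id.neg.const_cpow (Or.inl hc)
  have hd (c : ℂ) (hc : c ≠ 0) : DifferentiableAt ℂ (fun z ↦ c ^ (1 - z)) s :=
    (differentiableAt_id.const_sub 1).const_cpow (Or.inl hc)
  exact ((((hc _ hm1).add (hc _ hm2)).div_const 2).sub (((hd _ hm2).sub (hd _ hm1)).div
    (differentiableAt_id.const_sub 1) hs')).differentiableWithinAt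

lemma hasSum_inv_sub_inv_succ {M : ℕ} (hM : 0 < M) :
    HasSum (fun k : ℕ ↦ ((M + k : ℕ) : ℝ)⁻¹ - ((M + k + 1 : ℕ) : ℝ)⁻¹) (M : ℝ)⁻¹ := by
  have h : Tendsto (fun K : ℕ ↦ (M : ℝ)⁻¹ - ((M + K : ℕ) : ℝ)⁻¹) atTop (𝓝 ((M : ℝ)⁻¹ - 0)) :=
    tendsto_const_nhds.sub ((tendsto_inv_atTop_nhds_zero_nat (𝕜 := ℝ)).comp
      (tendsto_atTop_mono (fun n ↦ Nat.le_add_left n M) tendsto_id))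
  rw [sub_zero] at h
  rw [hasSum_iff_tendsto_nat_of_nonneg]
  · refine h.congr fun K ↦ ?_
    exact (Finset.sum_range_sub' (fun k : ℕ ↦ ((M + k : ℕ) : ℝ)⁻¹) K).symm
  · intro k
    have : (0 : ℝ) < M := by exact_mod_cast hM
    exact sub_nonneg.mpr (inv_anti₀ (by positivity) (by push_cast; linarith))

lemma sum_trapezoidError (M K : ℕ) {s : ℂ} :
    ∑ k ∈ range K, trapezoidError (M + k) s =
      ∑ m ∈ range (M + K), (m : ℂ) ^ (-s) - ∑ m ∈ range M, (m : ℂ) ^ (-s) - (M : ℂ) ^ (-s) / 2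
        + ((M + K : ℕ) : ℂ) ^ (-s) / 2
        - (((M + K : ℕ) : ℂ) ^ (1 - s) - (M : ℂ) ^ (1 - s)) / (1 - s) := by
  induction K with
  | zero => simp
  | succ K ih =>
    rw [sum_range_succ, ih, ← add_assoc, sum_range_succ, trapezoidError]
    ring

lemma norm_trapezoidError_add_le {M : ℕ} (hM : 0 < M) (k : ℕ) {s : ℂ} (hσ : 0 < s.re)
    (hs : s ≠ 1) :
    ‖trapezoidError (M + k) s‖ ≤ ‖s‖ * ‖s + 1‖ * (M : ℝ) ^ (-s.re) *
      (((M + k : ℕ) : ℝ)⁻¹ - ((M + k + 1 : ℕ) : ℝ)⁻¹) := by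
  have hM' : (0 : ℝ) < M := by exact_mod_cast hM
  have hle : (M : ℝ) ≤ (M + k : ℕ) := by exact_mod_cast Nat.le_add_right M k
  have h1 : (1 : ℝ) ≤ (M + k : ℕ) := by exact_mod_cast (by omega : 1 ≤ M + k)
  refine (norm_trapezoidError_le (by omega) hσ hs).trans ?_
  rw [div_div, div_eq_mul_inv, Nat.cast_succ (M + k)]
  generalize ((M + k : ℕ) : ℝ) = x at *
  have hpow : x ^ (-s.re) ≤ (M : ℝ) ^ (-s.re) :=
    Real.rpow_le_rpow_of_nonpos hM' hle (by linarith)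
  have hinv : (x ^ 2 * 2)⁻¹ ≤ x⁻¹ - (x + 1)⁻¹ := by
    rw [inv_sub_inv (by positivity) (by positivity), inv_eq_one_div,
      div_le_div_iff₀ (by positivity) (by positivity)]
    nlinarith
  gcongr

/-- The first-order Euler–Maclaurin formula for `ζ`. -/
lemma riemannZeta_eq_sum_add_tsum_trapezoidError_of_one_lt_re {M : ℕ} {s : ℂ} (hσ : 1 < s.re)
    (hsum : Summable fun k ↦ trapezoidError (M + k) s) :
    riemannZeta s = ∑ m ∈ range M, (m : ℂ) ^ (-s) + (M : ℂ) ^ (-s) / 2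
      - (M : ℂ) ^ (1 - s) / (1 - s) + ∑' k, trapezoidError (M + k) s := by
  have hzeta : HasSum (fun m : ℕ ↦ (m : ℂ) ^ (-s)) (riemannZeta s) := by
    rw [zeta_eq_tsum_one_div_nat_cpow hσ]
    have h := (summable_one_div_nat_cpow.mpr hσ).hasSum
    simpa only [one_div, ← cpow_neg] using h
  have hshift : Tendsto (fun K : ℕ ↦ M + K) atTop atTop :=
    tendsto_atTop_mono (fun n ↦ Nat.le_add_left n M) tendsto_id
  have hpow {c : ℂ} (hc : c.re < 0) :
      Tendsto (fun K : ℕ ↦ ((M + K : ℕ) : ℂ) ^ c) atTop (𝓝 0) := by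
    rw [tendsto_zero_iff_norm_tendsto_zero]
    have h := ((tendsto_rpow_neg_atTop (neg_pos.mpr hc)).comp
      tendsto_natCast_atTop_atTop).comp hshift
    refine h.congr' ?_
    filter_upwards [eventually_gt_atTop 0] with K hK
    simp only [Function.comp_apply, neg_neg]
    rw [norm_natCast_cpow_of_pos (by omega)]
  have h1 := hsum.hasSum.tendsto_sum_nat
  simp only [sum_trapezoidError] at h1
  have h2 := ((((hzeta.tendsto_sum_nat.comp hshift).sub_const
    (∑ m ∈ range M, (m : ℂ) ^ (-s))).sub_const ((M : ℂ) ^ (-s) / 2)).add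
      ((hpow (c := -s) (by simp; linarith)).div_const 2)).sub
        (((hpow (c := 1 - s) (by simp; linarith)).sub_const ((M : ℂ) ^ (1 - s))).div_const (1 - s))
  have h := tendsto_nhds_unique h1 h2
  rw [h]
  ring

lemma riemannZeta_eq_sum_add_tsum_trapezoidError {M : ℕ} (hM : 0 < M) {s : ℂ} (hσ : 0 < s.re)
    (hs : s.im ≠ 0) :
    riemannZeta s = ∑ m ∈ range M, (m : ℂ) ^ (-s) + (M : ℂ) ^ (-s) / 2
      - (M : ℂ) ^ (1 - s) / (1 - s) + ∑' k, trapezoidError (M + k) s := by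
  have hM' : (M : ℂ) ≠ 0 := by exact_mod_cast hM.ne'
  let R : ℝ := ‖s‖ + 3
  let U : Set ℂ := {z | 0 < z.re} ∩ {z | 0 < s.im * z.im} ∩ Metric.ball 0 R
  have hUo : IsOpen U := ((isOpen_lt continuous_const continuous_re).inter
    (isOpen_lt continuous_const (continuous_const.mul continuous_im))).inter Metric.isOpen_ball
  have hUc : Convex ℝ U := by
    refine ((convex_halfSpace_re_gt 0).inter ?_).inter (convex_ball 0 R)
    exact convex_halfSpace_gt (f := fun z : ℂ ↦ s.im * z.im)
      ⟨fun x y ↦ by simp [mul_add], fun c x ↦ by simp [mul_left_comm]⟩ 0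
  have hU1 : U ⊆ {1}ᶜ := by
    rintro z ⟨⟨-, hz⟩, -⟩ rfl
    simp at hz
  have hsU : s ∈ U := ⟨⟨hσ, mul_self_pos.mpr hs⟩, by simp [R]⟩
  have h2U : s + 2 ∈ U := by
    refine ⟨⟨by simp; linarith, by simpa using mul_self_pos.mpr hs⟩, ?_⟩
    rw [mem_ball_zero_iff]
    calc ‖s + 2‖ ≤ ‖s‖ + ‖(2 : ℂ)‖ := norm_add_le _ _
      _ < R := by simp [R]; norm_num
  let u : ℕ → ℝ := fun k ↦ R * (R + 1) * (((M + k : ℕ) : ℝ)⁻¹ - ((M + k + 1 : ℕ) : ℝ)⁻¹)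
  have hu : Summable u := (hasSum_inv_sub_inv_succ hM).summable.mul_left _
  have hle : ∀ (k : ℕ) (z : ℂ), z ∈ U → ‖trapezoidError (M + k) z‖ ≤ u k := by
    intro k z hz
    have hz0 : 0 < z.re := hz.1.1
    have hzR : ‖z‖ ≤ R := (mem_ball_zero_iff.mp hz.2).le
    have hz1 : ‖z + 1‖ ≤ R + 1 := (norm_add_le _ _).trans (by simpa using hzR)
    refine (norm_trapezoidError_add_le hM k hz0 (hU1 hz)).trans ?_
    have h1 : (M : ℝ) ^ (-z.re) ≤ 1 :=
      Real.rpow_le_one_of_one_le_of_nonpos (by exact_mod_cast hM) (by linarith)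
    have h2 : (0 : ℝ) ≤ ((M + k : ℕ) : ℝ)⁻¹ - ((M + k + 1 : ℕ) : ℝ)⁻¹ :=
      sub_nonneg.mpr (inv_anti₀ (by positivity) (by push_cast; linarith))
    have hR : 0 ≤ R := by positivity
    refine mul_le_mul_of_nonneg_right ?_ h2
    calc ‖z‖ * ‖z + 1‖ * (M : ℝ) ^ (-z.re) ≤ R * (R + 1) * 1 := by gcongr
      _ = _ := mul_one _
  have hsummable {z : ℂ} (hz : z ∈ U) : Summable fun k ↦ trapezoidError (M + k) z :=
    Summable.of_norm_bounded hu fun k ↦ hle k z hz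
  have htsum : DifferentiableOn ℂ (fun z ↦ ∑' k, trapezoidError (M + k) z) U :=
    differentiableOn_tsum_of_summable_norm hu
      (fun k ↦ (differentiableOn_trapezoidError (by omega)).mono hU1) hUo hle
  have hrhs : DifferentiableOn ℂ (fun z ↦ ∑ m ∈ range M, (m : ℂ) ^ (-z) + (M : ℂ) ^ (-z) / 2
      - (M : ℂ) ^ (1 - z) / (1 - z) + ∑' k, trapezoidError (M + k) z) U := by
    refine DifferentiableOn.add (fun z hz ↦ ?_) htsum
    have hz1 : 1 - z ≠ 0 := sub_ne_zero.mpr (Ne.symm (hU1 hz))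
    have hz0 : -z ≠ 0 := neg_ne_zero.mpr fun h ↦ by
      have := hz.1.1
      simp [h] at this
    refine DifferentiableAt.differentiableWithinAt (.sub (.add (.fun_sum fun m _ ↦ ?_) ?_) ?_)
    · exact differentiableAt_id.neg.const_cpow (Or.inr hz0)
    · exact (differentiableAt_id.neg.const_cpow (Or.inl hM')).div_const 2
    · exact ((differentiableAt_id.const_sub 1).const_cpow (Or.inl hM')).div
        (differentiableAt_id.const_sub 1) hz1
  have hzeta : DifferentiableOn ℂ riemannZeta U := fun z hz ↦
    (differentiableAt_riemannZeta (hU1 hz)).differentiableWithinAt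
  refine (hzeta.analyticOnNhd hUo).eqOn_of_preconnected_of_eventuallyEq
    (hrhs.analyticOnNhd hUo) hUc.isPreconnected h2U ?_ hsU
  filter_upwards [hUo.mem_nhds h2U, (isOpen_lt continuous_const continuous_re).mem_nhds
    (show 1 < (s + 2).re by simp; linarith)] with z hzU hz
  exact riemannZeta_eq_sum_add_tsum_trapezoidError_of_one_lt_re hz (hsummable hzU)

lemma norm_riemannZeta_sub_sum_le {M : ℕ} (hM : 0 < M) {s : ℂ} (hσ : 0 < s.re)
    (hs : s.im ≠ 0) :
    ‖riemannZeta s - ∑ m ∈ range M, (m : ℂ) ^ (-s)‖ ≤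
      (M : ℝ) ^ (-s.re) + (M : ℝ) ^ (1 - s.re) / |s.im|
        + ‖s‖ * ‖s + 1‖ * (M : ℝ) ^ (-s.re) / M := by
  have hs1 : s ≠ 1 := fun h ↦ hs (by simp [h])
  have htail : ‖∑' k, trapezoidError (M + k) s‖ ≤ ‖s‖ * ‖s + 1‖ * (M : ℝ) ^ (-s.re) / M := by
    rw [div_eq_mul_inv]
    exact tsum_of_norm_bounded ((hasSum_inv_sub_inv_succ hM).mul_left _)
      fun k ↦ norm_trapezoidError_add_le hM k hσ hs1
  have hpole : ‖(M : ℂ) ^ (1 - s) / (1 - s)‖ ≤ (M : ℝ) ^ (1 - s.re) / |s.im| := by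
    rw [norm_div, norm_natCast_cpow_of_pos hM, sub_re, one_re]
    have : |s.im| ≤ ‖1 - s‖ := by simpa using abs_im_le_norm (1 - s)
    gcongr
  have hhalf : ‖(M : ℂ) ^ (-s) / 2‖ ≤ (M : ℝ) ^ (-s.re) := by
    rw [norm_div, norm_natCast_cpow_of_pos hM, neg_re, norm_ofNat]
    exact half_le_self (by positivity)
  rw [riemannZeta_eq_sum_add_tsum_trapezoidError hM hσ hs,
    show ∀ a b c d : ℂ, a + b - c + d - a = b - c + d by intros; ring]
  exact (norm_add_le _ _).trans (add_le_add ((norm_sub_le _ _).trans (add_le_add hhalf hpole)) htail)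

lemma sum_sum_cos_dist_nonneg (N : ℕ) (θ : ℝ) :
    0 ≤ ∑ j ∈ range N, ∑ k ∈ range N, Real.cos (Nat.dist j k * θ) := by
  have h (j k : ℕ) : Real.cos (Nat.dist j k * θ) =
      Real.cos (j * θ) * Real.cos (k * θ) + Real.sin (j * θ) * Real.sin (k * θ) := by
    rw [← Real.cos_sub, ← sub_mul]
    rcases le_total j k with hjk | hjk
    · rw [Nat.dist_eq_sub_of_le hjk, Nat.cast_sub hjk, ← Real.cos_neg]
      ring_nf
    · rw [Nat.dist_eq_sub_of_le_right hjk, Nat.cast_sub hjk]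
  simp only [h, sum_add_distrib, ← sum_mul_sum]
  exact add_nonneg (mul_self_nonneg _) (mul_self_nonneg _)

lemma sum_dist_le {g : ℕ → ℝ} (hg : ∀ n, 0 ≤ g n) {j N : ℕ} (hj : j ≤ N) :
    ∑ k ∈ range N, g (Nat.dist j k) ≤ g 0 + 2 * ∑ i ∈ range N, g (i + 1) := by
  have hleft : ∑ k ∈ range j, g (Nat.dist j k) ≤ ∑ i ∈ range N, g (i + 1) := by
    rw [← sum_range_reflect]
    calc _ = ∑ i ∈ range j, g (i + 1) := sum_congr rfl fun i hi ↦ by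
          have := mem_range.mp hi
          rw [Nat.dist_eq_sub_of_le_right (by omega)]
          congr 1
          omega
      _ ≤ _ := sum_le_sum_of_subset_of_nonneg (range_mono hj) fun i _ _ ↦ hg _
  have hright : ∑ k ∈ Ico j N, g (Nat.dist j k) ≤ g 0 + ∑ i ∈ range N, g (i + 1) := by
    rw [sum_Ico_eq_sum_range, add_comm, ← sum_range_succ']
    calc _ = ∑ i ∈ range (N - j), g i := sum_congr rfl fun i _ ↦ by
          rw [Nat.dist_eq_sub_of_le (by omega), Nat.add_sub_cancel_left]
      _ ≤ _ := sum_le_sum_of_subset_of_nonneg (range_mono (by omega)) fun i _ _ ↦ hg _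
  rw [← sum_range_add_sum_Ico _ hj]
  linarith

lemma re_natCast_cpow_neg {D : ℝ} (hD : 0 < D) (m : ℕ) (t : ℝ) :
    ((m : ℂ) ^ (-((D : ℂ) + t * I))).re = (m : ℝ) ^ (-D) * Real.cos (t * Real.log m) := by
  rcases Nat.eq_zero_or_pos m with rfl | hm
  · have : -((D : ℂ) + t * I) ≠ 0 := fun h ↦ hD.ne' (by simpa using congrArg re h)
    rw [Nat.cast_zero, zero_cpow this, zero_re, Nat.cast_zero,
      Real.zero_rpow (neg_ne_zero.mpr hD.ne'), zero_mul]
  have hm' : (0 : ℝ) < m := by exact_mod_cast hm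
  rw [cpow_def_of_ne_zero (by exact_mod_cast hm.ne'), ← natCast_log, exp_re,
    Real.rpow_def_of_pos hm']
  generalize Real.log m = x
  simp [mul_comm t]

lemma sum_range_succ_rpow_neg_le {D : ℝ} (hD : 1 / 2 ≤ D) (M : ℕ) :
    ∑ m ∈ range (M + 1), (m : ℝ) ^ (-D) ≤ 2 * √M := by
  induction M with
  | zero => simp [Real.zero_rpow (by linarith : -D ≠ 0)]
  | succ M ih =>
    rw [sum_range_succ]
    have hM : (1 : ℝ) ≤ (M + 1 : ℕ) := by exact_mod_cast M.succ_pos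
    have hpow : ((M + 1 : ℕ) : ℝ) ^ (-D) ≤ (√(M + 1 : ℕ))⁻¹ := by
      rw [Real.sqrt_eq_rpow, ← Real.rpow_neg (by positivity)]
      exact Real.rpow_le_rpow_of_exponent_le hM (by linarith)
    have hpos : 0 < √(M + 1 : ℕ) := Real.sqrt_pos.mpr (by positivity)
    have h1 : √(M + 1 : ℕ) ^ 2 = M + 1 := by rw [Real.sq_sqrt (by positivity)]; push_cast; rfl
    have h2 : √(M : ℝ) ^ 2 = M := Real.sq_sqrt (by positivity)
    have hstep : (√(M + 1 : ℕ))⁻¹ ≤ 2 * √(M + 1 : ℕ) - 2 * √(M : ℝ) := by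
      rw [inv_le_iff_one_le_mul₀ hpos]
      nlinarith [sq_nonneg (√(M + 1 : ℕ) - √(M : ℝ))]
    linarith

/-- The Fejér means of the partial sums of `ζ` along a vertical progression are bounded below by
the contribution of the term `m = 1`. -/
lemma sq_le_sum_sum_dist {D : ℝ} (hD : 0 < D) (q : ℝ) {M : ℕ} (hM : 1 < M) (N : ℕ) :
    (N : ℝ) ^ 2 ≤ ∑ j ∈ range N, ∑ k ∈ range N,
      (∑ m ∈ range M, (m : ℂ) ^ (-((D : ℂ) + ((Nat.dist j k : ℝ) * q : ℝ) * I))).re := by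
  have h : ∑ j ∈ range N, ∑ k ∈ range N,
      (∑ m ∈ range M, (m : ℂ) ^ (-((D : ℂ) + ((Nat.dist j k : ℝ) * q : ℝ) * I))).re =
      ∑ m ∈ range M, (m : ℝ) ^ (-D) *
        ∑ j ∈ range N, ∑ k ∈ range N, Real.cos (Nat.dist j k * (q * Real.log m)) := by
    simp only [re_sum, re_natCast_cpow_neg hD, mul_sum, mul_assoc]
    exact (sum_congr rfl fun j _ ↦ sum_comm).trans sum_comm
  rw [h]
  refine le_trans ?_ (single_le_sum (fun m _ ↦ mul_nonneg (by positivity)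
    (sum_sum_cos_dist_nonneg N _)) (mem_range.mpr hM))
  simp [sq]

lemma exists_riemannZeta_ne_zero_of_half_le {D : ℝ} (hD : 1 / 2 ≤ D) (hD1 : D < 1) {q : ℝ}
    (hq : q ≠ 0) :
    ∃ n : ℕ, 0 < n ∧ riemannZeta ((D : ℂ) + ((n : ℝ) * q : ℝ) * I) ≠ 0 := by
  by_contra! hzero
  have hD0 : 0 < D := by linarith
  have hq' : 0 < |q| := abs_pos.mpr hq
  let C : ℝ := 1 + (2 + |q|) ^ 2
  obtain ⟨l, hl⟩ := exists_nat_gt (max 2 (2 + 3 * C + 18 / |q|))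
  have hl2 : (2 : ℝ) < l := (le_max_left _ _).trans_lt hl
  have hlC := (le_max_right _ _).trans_lt hl
  have hl0 : 0 < l := by exact_mod_cast (by linarith : (0 : ℝ) < l)
  have hC : 0 < C := by positivity
  set L : ℝ := (l : ℝ) with hL
  have hL1 : 1 ≤ L := by linarith
  have hMroot : √((l ^ 12 : ℕ) : ℝ) = L ^ 6 := by
    rw [show ((l ^ 12 : ℕ) : ℝ) = (L ^ 6) ^ 2 by push_cast; ring]
    exact Real.sqrt_sq (by positivity)
  have hM1 : (1 : ℝ) ≤ (l ^ 12 : ℕ) := by exact_mod_cast Nat.one_le_pow _ _ hl0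
  have hMneg : ((l ^ 12 : ℕ) : ℝ) ^ (-D) ≤ 1 / L ^ 6 := by
    rw [one_div, ← hMroot, Real.sqrt_eq_rpow, ← Real.rpow_neg (by positivity)]
    exact Real.rpow_le_rpow_of_exponent_le hM1 (by linarith)
  have hMone : ((l ^ 12 : ℕ) : ℝ) ^ (1 - D) ≤ L ^ 6 := by
    rw [← hMroot, Real.sqrt_eq_rpow]
    exact Real.rpow_le_rpow_of_exponent_le hM1 (by linarith)
  let g : ℕ → ℝ := fun n ↦ (if n = 0 then 2 * L ^ 6 else 0) + L ^ 6 / (n * |q|) + C / L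
  have hg : ∀ n, 0 ≤ g n := fun n ↦ by
    have : (0 : ℝ) ≤ if n = 0 then 2 * L ^ 6 else 0 := by split_ifs <;> positivity
    positivity
  have hbound : ∀ n ≤ l ^ 8,
      (∑ m ∈ range (l ^ 12), (m : ℂ) ^ (-((D : ℂ) + ((n : ℝ) * q : ℝ) * I))).re ≤ g n := by
    intro n hn
    rcases Nat.eq_zero_or_pos n with rfl | hn0
    · have h := sum_range_succ_rpow_neg_le hD (l ^ 12)
      rw [hMroot, sum_range_succ] at h
      have hlast : (0 : ℝ) ≤ ((l ^ 12 : ℕ) : ℝ) ^ (-D) := by positivity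
      simp only [re_sum, re_natCast_cpow_neg hD0]
      simp only [g, CharP.cast_eq_zero, zero_mul, Real.cos_zero, mul_one, if_true, div_zero,
        add_zero]
      have : 0 ≤ C / L := by positivity
      linarith
    have hn' : (0 : ℝ) < n := by exact_mod_cast hn0
    have hnl : (n : ℝ) ≤ L ^ 8 := by rw [hL]; exact_mod_cast hn
    set s : ℂ := (D : ℂ) + ((n : ℝ) * q : ℝ) * I with hs
    have hre : s.re = D := by simp [hs]
    have him : s.im = n * q := by simp [hs]
    have h := norm_riemannZeta_sub_sum_le (M := l ^ 12) (pow_pos hl0 _) (s := s)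
      (by rwa [hre]) (by rw [him]; positivity)
    rw [hzero n hn0, zero_sub, norm_neg, hre, him, abs_mul, Nat.abs_cast] at h
    have hnorm : ‖s‖ ≤ 1 + L ^ 8 * |q| := by
      refine (norm_le_abs_re_add_abs_im s).trans ?_
      rw [hre, him, abs_mul, Nat.abs_cast, abs_of_pos hD0]
      gcongr
    have hL8 : 1 ≤ L ^ 8 := one_le_pow₀ hL1
    have hs1 : ‖s‖ ≤ (2 + |q|) * L ^ 8 := by linarith
    have hs2 : ‖s + 1‖ ≤ (2 + |q|) * L ^ 8 := by
      refine (norm_add_le _ _).trans ?_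
      rw [norm_one]
      linarith
    have h3 : ‖s‖ * ‖s + 1‖ * ((l ^ 12 : ℕ) : ℝ) ^ (-D) / (l ^ 12 : ℕ) ≤
        (2 + |q|) ^ 2 / L := by
      calc _ ≤ ((2 + |q|) * L ^ 8) * ((2 + |q|) * L ^ 8) * (1 / L ^ 6) / (l ^ 12 : ℕ) := by
            gcongr
        _ = (2 + |q|) ^ 2 / L ^ 2 := by
            rw [Nat.cast_pow, ← hL]
            field_simp
        _ ≤ _ := by
            gcongr
            exact le_self_pow₀ hL1 (by norm_num)
    have h4 : 1 / L ^ 6 ≤ 1 / L := by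
      gcongr
      exact le_self_pow₀ hL1 (by norm_num)
    have h5 : ((l ^ 12 : ℕ) : ℝ) ^ (1 - D) / (n * |q|) ≤ L ^ 6 / (n * |q|) := by gcongr
    have h6 : g n = L ^ 6 / (n * |q|) + (1 / L + (2 + |q|) ^ 2 / L) := by
      simp only [g, C, hn0.ne', if_false]
      ring
    rw [h6]
    exact (re_le_norm _).trans (by linarith)
  have hlower := sq_le_sum_sum_dist hD0 q (M := l ^ 12)
    (Nat.one_lt_pow (by norm_num) (by exact_mod_cast (by linarith : (1 : ℝ) < l))) (l ^ 8)
  have hupper : ∑ j ∈ range (l ^ 8), ∑ k ∈ range (l ^ 8),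
      (∑ m ∈ range (l ^ 12), (m : ℂ) ^ (-((D : ℂ) + ((Nat.dist j k : ℝ) * q : ℝ) * I))).re ≤
      L ^ 8 * (g 0 + 2 * ∑ i ∈ range (l ^ 8), g (i + 1)) := by
    calc _ ≤ ∑ j ∈ range (l ^ 8), (g 0 + 2 * ∑ i ∈ range (l ^ 8), g (i + 1)) := by
          refine sum_le_sum fun j hj ↦ (sum_le_sum fun k hk ↦ hbound _ ?_).trans
            (sum_dist_le hg (mem_range.mp hj).le)
          have := mem_range.mp hj
          have := mem_range.mp hk
          simp only [Nat.dist]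
          omega
      _ = _ := by rw [sum_const, card_range, nsmul_eq_mul, Nat.cast_pow]
  have hharm : ∑ i ∈ range (l ^ 8), ((i + 1 : ℕ) : ℝ)⁻¹ ≤ 9 * L := by
    have h := harmonic_le_one_add_log (l ^ 8)
    have hlog : Real.log L ≤ L - 1 := Real.log_le_sub_one_of_pos (by linarith)
    rw [harmonic] at h
    push_cast [Real.log_pow] at h ⊢
    linarith
  have hsum : ∑ i ∈ range (l ^ 8), g (i + 1) ≤ L ^ 6 / |q| * (9 * L) + L ^ 8 * (C / L) := by
    have h : ∀ i : ℕ, g (i + 1) = L ^ 6 / |q| * ((i + 1 : ℕ) : ℝ)⁻¹ + C / L := fun i ↦ by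
      simp only [g, Nat.succ_ne_zero, if_false, zero_add]
      ring
    simp only [h, sum_add_distrib, ← mul_sum, sum_const, card_range, nsmul_eq_mul]
    rw [Nat.cast_pow]
    gcongr
  have hg0 : g 0 = 2 * L ^ 6 + C / L := by simp [g]
  have hfinal : L ^ 8 ≤ 2 * L ^ 6 + C / L + 2 * (L ^ 6 / |q| * (9 * L) + L ^ 8 * (C / L)) := by
    have h := hlower.trans hupper
    rw [Nat.cast_pow, sq, hg0] at h
    have := le_of_mul_le_mul_left h (by positivity)
    linarith
  have h1 : L ^ 6 ≤ L ^ 7 := pow_le_pow_right₀ hL1 (by norm_num)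
  have h2 : C / L ≤ C * L ^ 7 := by
    rw [div_le_iff₀ (by linarith), mul_assoc, ← pow_succ]
    exact le_mul_of_one_le_right hC.le (one_le_pow₀ hL1)
  have h3 : 2 * (L ^ 6 / |q| * (9 * L) + L ^ 8 * (C / L)) = (18 / |q| + 2 * C) * L ^ 7 := by
    field_simp
    ring
  have h4 : (2 + 3 * C + 18 / |q|) * L ^ 7 < L * L ^ 7 :=
    mul_lt_mul_of_pos_right hlC (by positivity)
  rw [h3] at hfinal
  nlinarith

/-- The Riemann zeta function has no infinite vertical arithmetic progression
of zeroes: for every `D ∈ (0,1)` and every `p > 0`, there is a positive integer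
`n` with `ζ(D + inp) ≠ 0`. -/
theorem no_infinite_vertical_arithmetic_progression_of_zeroes
    (D : ℝ) (hD0 : 0 < D) (hD1 : D < 1) (p : ℝ) (hp : 0 < p) :
    ∃ n : ℕ, 0 < n ∧ riemannZeta ((D : ℂ) + ((n : ℝ) * p : ℝ) * Complex.I) ≠ 0 := by
  rcases le_total (1 / 2) D with hD | hD
  · exact exists_riemannZeta_ne_zero_of_half_le hD hD1 hp.ne'
  obtain ⟨n, hn, h⟩ := exists_riemannZeta_ne_zero_of_half_le (D := 1 - D) (by linarith)
    (by linarith) (neg_ne_zero.mpr hp.ne')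
  refine ⟨n, hn, fun hzero ↦ h ?_⟩
  set s : ℂ := (D : ℂ) + ((n : ℝ) * p : ℝ) * I with hs
  have hre : s.re = D := by simp [hs]
  have hs0 : ∀ k : ℕ, s ≠ -k := fun k hk ↦ by
    have : s.re = -k := by simp [hk]
    have : (0 : ℝ) ≤ k := k.cast_nonneg
    linarith
  have hs1 : s ≠ 1 := fun h1 ↦ hD1.ne (by rw [← hre, h1, one_re])
  have heq : ((1 - D : ℝ) : ℂ) + ((n : ℝ) * -p : ℝ) * I = 1 - s := by
    rw [hs]
    push_cast
    ring
  rw [heq, riemannZeta_one_sub hs0 hs1, hzero, mul_zero]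
end

section
/- Let D ∈ (0,1) and let Ω be an ordinary fractal string with lengths l_1 ≥ l_2 ≥ ... > 0. Then Ω is Minkowski measurable of dimension D (i.e., M := lim_{ε→0⁺} vol₁(Ω_ε)/ε^{1−D} exists in (0,∞)) if and only if there exists L ∈ (0,∞) such that l_j · j^{1/D} → L as j → ∞, and in that case the Minkowski content is M = 2^{1−D} L^D / (1 − D); moreover these conditions hold if and only if N_L(x)/x^D → L^D as x → +∞, where N_L(x) := #{j : l_j ≥ 1/x}. -/
open MeasureTheory Filter Topology Asymptotics

/-- An ordinary fractal string: a bounded open subset `Ω ⊆ ℝ` realized as a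
countable disjoint union of (infinitely many) nonempty open intervals, whose
lengths `l_j = b_j - a_j` are listed in nonincreasing order. -/
structure FractalString where
  a : ℕ → ℝ
  b : ℕ → ℝ
  lt : ∀ j, a j < b j
  disj : Pairwise fun i j => Disjoint (Set.Ioo (a i) (b i)) (Set.Ioo (a j) (b j))
  bdd : Bornology.IsBounded (⋃ j, Set.Ioo (a j) (b j))
  anti : Antitone fun j => b j - a j

namespace FractalString

/-- The lengths `l_j` of the string. -/
def l (S : FractalString) (j : ℕ) : ℝ := S.b j - S.a j

/-- The bounded open set `Ω ⊆ ℝ` of the string. -/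
def Omega (S : FractalString) : Set ℝ := ⋃ j, Set.Ioo (S.a j) (S.b j)

/-- The inner `ε`-neighborhood `Ω_ε = {x ∈ Ω : dist(x, ∂Ω) < ε}` of `∂Ω`. -/
def innerNbhd (S : FractalString) (ε : ℝ) : Set ℝ :=
  {x ∈ S.Omega | Metric.infDist x (frontier S.Omega) < ε}

/-- The dimension of the string: the abscissa of convergence
`D = inf{σ : Σ_j l_j^σ < ∞}` of its geometric zeta function. -/
noncomputable def dimension (S : FractalString) : ℝ :=
  sInf {σ : ℝ | Summable fun j => S.l j ^ σ}

/-- The spectral counting function `N_ν(x) = Σ_j ⌊l_j x⌋`. -/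
noncomputable def Nnu (S : FractalString) (x : ℝ) : ℝ :=
  ∑' j : ℕ, (⌊S.l j * x⌋ : ℝ)

/-- The Weyl term `W(x) = vol₁(Ω)·x = (Σ_j l_j)·x`. -/
noncomputable def weyl (S : FractalString) (x : ℝ) : ℝ :=
  (∑' j : ℕ, S.l j) * x

/-- `vol₁(Ω_ε)/ε^{1-D} → M` as `ε → 0⁺`. -/
def MinkTendsto (S : FractalString) (D M : ℝ) : Prop :=
  Tendsto (fun ε : ℝ => (volume (S.innerNbhd ε)).toReal / ε ^ (1 - D))
    (𝓝[>] 0) (𝓝 M)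

/-- The string is Minkowski measurable of dimension `D`: the limit
`M = lim_{ε→0⁺} vol₁(Ω_ε)/ε^{1-D}` exists in `(0, ∞)`. -/
def MinkowskiMeasurable (S : FractalString) (D : ℝ) : Prop :=
  ∃ M, 0 < M ∧ S.MinkTendsto D M

/-- The geometric counting function `N_L(x) = #{j : l_j ≥ 1/x}`. -/
noncomputable def NL (S : FractalString) (x : ℝ) : ℕ :=
  {j : ℕ | 1 / x ≤ S.l j}.ncard

end FractalString

namespace FractalString

lemma tendsto_const_mul_nhdsGT_zero {k : ℝ} (hk : 0 < k) :
    Tendsto (fun s : ℝ => k * s) (𝓝[>] 0) (𝓝[>] 0) := by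
  refine tendsto_nhdsWithin_iff.2 ⟨?_, ?_⟩
  · have : Tendsto (fun s : ℝ => k * s) (𝓝 0) (𝓝 (k * 0)) := tendsto_id.const_mul k
    rw [mul_zero] at this
    exact this.mono_left nhdsWithin_le_nhds
  · filter_upwards [self_mem_nhdsWithin] with s hs
    exact mul_pos hk hs

/-- The number of terms of a sequence that are at least `s`. -/
noncomputable def countGe (l : ℕ → ℝ) (s : ℝ) : ℕ := {j : ℕ | s ≤ l j}.ncard

section Sequences

variable {l : ℕ → ℝ} {D A : ℝ}

lemma setOf_le_eq_Iio (hanti : Antitone l) (hl : Tendsto l atTop (𝓝 0)) {s : ℝ} (hs : 0 < s) :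
    {j : ℕ | s ≤ l j} = Set.Iio (countGe l s) := by
  classical
  have hex : ∃ m, l m < s := (hl.eventually_lt_const hs).exists
  have h : {j : ℕ | s ≤ l j} = Set.Iio (Nat.find hex) := by
    ext j
    simp only [Set.mem_ofPred_eq, Set.mem_Iio, Nat.lt_find_iff, not_lt]
    exact ⟨fun hj m hm => hj.trans (hanti hm), fun hj => hj j le_rfl⟩
  have hc : countGe l s = Nat.find hex := by
    rw [countGe, h, ← Finset.coe_Iio, Set.ncard_coe_finset, Nat.card_Iio]
  rw [hc, h]

lemma lt_countGe_iff (hanti : Antitone l) (hl : Tendsto l atTop (𝓝 0)) {s : ℝ} (hs : 0 < s)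
    (j : ℕ) : j < countGe l s ↔ s ≤ l j := by
  have h := setOf_le_eq_Iio hanti hl hs
  exact (Set.ext_iff.mp h j).symm

lemma tendsto_countGe (hanti : Antitone l) (hpos : ∀ j, 0 < l j) (hl : Tendsto l atTop (𝓝 0)) :
    Tendsto (countGe l) (𝓝[>] 0) atTop := by
  refine tendsto_atTop.2 fun m => ?_
  filter_upwards [Ioo_mem_nhdsGT (hpos m)] with s hs
  exact ((lt_countGe_iff hanti hl hs.1 m).2 hs.2.le).le

lemma tendsto_mul_rpow_inv_iff (hD : 0 < D) (hpos : ∀ j, 0 < l j) {L : ℝ} (hL : 0 < L) :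
    Tendsto (fun j : ℕ => l j * (j : ℝ) ^ (1 / D)) atTop (𝓝 L) ↔
      Tendsto (fun j : ℕ => (j : ℝ) * l j ^ D) atTop (𝓝 (L ^ D)) := by
  constructor
  · intro h
    refine (h.rpow_const (p := D) (Or.inl hL.ne')).congr fun j => ?_
    rw [Real.mul_rpow (hpos j).le (by positivity), ← Real.rpow_mul (by positivity),
      one_div_mul_cancel hD.ne', Real.rpow_one, mul_comm]
  · intro h
    have h' := h.rpow_const (p := 1 / D) (Or.inl (Real.rpow_pos_of_pos hL D).ne')
    rw [← Real.rpow_mul hL.le, mul_one_div_cancel hD.ne', Real.rpow_one] at h'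
    refine h'.congr fun j => ?_
    rw [Real.mul_rpow (by positivity) (Real.rpow_nonneg (hpos j).le _),
      ← Real.rpow_mul (hpos j).le, mul_one_div_cancel hD.ne', Real.rpow_one, mul_comm]

lemma tendsto_countGe_of_tendsto (hD : 0 < D) (hanti : Antitone l) (hpos : ∀ j, 0 < l j)
    (hl : Tendsto l atTop (𝓝 0))
    (h : Tendsto (fun j : ℕ => (j : ℝ) * l j ^ D) atTop (𝓝 A)) :
    Tendsto (fun s => (countGe l s : ℝ) * s ^ D) (𝓝[>] 0) (𝓝 A) := by
  have hn := tendsto_countGe hanti hpos hl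
  have hlow := h.comp hn
  have hsucc : Tendsto (fun j : ℕ => ((j + 1 : ℕ) : ℝ) * l j ^ D) atTop (𝓝 A) := by
    have h0 : Tendsto (fun j : ℕ => l j ^ D) atTop (𝓝 0) := by
      simpa [Real.zero_rpow hD.ne'] using hl.rpow_const (p := D) (Or.inr hD.le)
    simpa [add_mul] using h.add h0
  have hup := hsucc.comp ((tendsto_sub_atTop_nat 1).comp hn)
  refine tendsto_of_tendsto_of_tendsto_of_le_of_le' hlow hup ?_ ?_
  · filter_upwards [self_mem_nhdsWithin] with s hs
    have hs : 0 < s := hs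
    have : l (countGe l s) < s := by
      by_contra! hc
      exact lt_irrefl _ ((lt_countGe_iff hanti hl hs _).2 hc)
    exact mul_le_mul_of_nonneg_left (Real.rpow_le_rpow (hpos _).le this.le hD.le) (by positivity)
  · filter_upwards [self_mem_nhdsWithin, hn.eventually_ge_atTop 1] with s hs h1
    have hs : 0 < s := hs
    have : s ≤ l (countGe l s - 1) := (lt_countGe_iff hanti hl hs _).1 (by omega)
    simp only [Function.comp_apply, Nat.sub_add_cancel h1]
    gcongr

lemma tendsto_of_tendsto_countGe (hanti : Antitone l) (hpos : ∀ j, 0 < l j)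
    (hl : Tendsto l atTop (𝓝 0))
    (h : Tendsto (fun s => (countGe l s : ℝ) * s ^ D) (𝓝[>] 0) (𝓝 A)) :
    Tendsto (fun j : ℕ => (j : ℝ) * l j ^ D) atTop (𝓝 A) := by
  have hone : Tendsto (fun j : ℕ => 1 + 1 / ((j : ℝ) + 1)) atTop (𝓝 1) := by
    simpa using tendsto_one_div_add_atTop_nhds_zero_nat.const_add (1 : ℝ)
  have hgt : ∀ j : ℕ, 1 < 1 + 1 / ((j : ℝ) + 1) := fun j => by
    have : 0 < 1 / ((j : ℝ) + 1) := by positivity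
    linarith
  have hs : Tendsto (fun j : ℕ => l j * (1 + 1 / ((j : ℝ) + 1))) atTop (𝓝[>] 0) := by
    refine tendsto_nhdsWithin_iff.2 ⟨by simpa using hl.mul hone, .of_forall fun j => ?_⟩
    exact mul_pos (hpos j) (zero_lt_one.trans (hgt j))
  have hup := h.comp (tendsto_nhdsWithin_iff.2 ⟨hl, .of_forall hpos⟩)
  have hlow := (h.comp hs).div (hone.rpow_const (p := D) (Or.inl one_ne_zero)) (by simp)
  rw [Real.one_rpow, div_one] at hlow
  refine tendsto_of_tendsto_of_tendsto_of_le_of_le hlow hup (fun j => ?_) (fun j => ?_)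
  · have h1 : 0 < 1 + 1 / ((j : ℝ) + 1) := zero_lt_one.trans (hgt j)
    have hle : countGe l (l j * (1 + 1 / ((j : ℝ) + 1))) ≤ j := by
      by_contra! hc
      have := (lt_countGe_iff hanti hl (mul_pos (hpos j) h1) j).1 hc
      nlinarith [hpos j, hgt j]
    simp only [Function.comp_apply, Pi.div_apply]
    rw [div_le_iff₀ (Real.rpow_pos_of_pos h1 D), mul_assoc, ← Real.mul_rpow (hpos j).le h1.le]
    exact mul_le_mul_of_nonneg_right (by exact_mod_cast hle)
      (Real.rpow_nonneg (mul_pos (hpos j) h1).le _)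
  · have : j ≤ countGe l (l j) := ((lt_countGe_iff hanti hl (hpos j) j).2 le_rfl).le
    exact mul_le_mul_of_nonneg_right (Nat.cast_le.2 this) (Real.rpow_nonneg (hpos j).le _)

lemma summable_min (hpos : ∀ j, 0 < l j) (hsum : Summable l) {t : ℝ} (ht : 0 ≤ t) :
    Summable fun j => min t (l j) :=
  hsum.of_nonneg_of_le (fun j => le_min ht (hpos j).le) fun _ => min_le_right _ _

lemma hasSum_ite_countGe (hanti : Antitone l) (hl : Tendsto l atTop (𝓝 0)) {s : ℝ}
    (hs : 0 < s) {R : Type*} [AddCommMonoidWithOne R] [TopologicalSpace R] :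
    HasSum (fun j => if s ≤ l j then (1 : R) else 0) (countGe l s : R) := by
  have h : ∀ j ∉ Finset.range (countGe l s), (if s ≤ l j then (1 : R) else 0) = 0 := by
    intro j hj
    rw [Finset.mem_range, lt_countGe_iff hanti hl hs] at hj
    simp [hj]
  have hsum : ∑ j ∈ Finset.range (countGe l s), (if s ≤ l j then (1 : R) else 0) =
      (countGe l s : R) := by
    rw [Finset.sum_congr rfl (g := fun _ => (1 : R))]
    · simp
    · intro j hj
      rw [Finset.mem_range, lt_countGe_iff hanti hl hs] at hj
      simp [hj]
  exact hsum ▸ hasSum_sum_of_ne_finset_zero h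

lemma mul_countGe_le (hanti : Antitone l) (hpos : ∀ j, 0 < l j) (hsum : Summable l) {s t : ℝ}
    (hs : 0 < s) (hst : s ≤ t) :
    (t - s) * countGe l t ≤ ∑' j, min t (l j) - ∑' j, min s (l j) := by
  have hl := hsum.tendsto_atTop_zero
  have h := (hasSum_ite_countGe hanti hl (hs.trans_le hst) (R := ℝ)).mul_left (t - s)
  refine hasSum_le (fun j => ?_) h ((summable_min hpos hsum (hs.le.trans hst)).hasSum.sub
    (summable_min hpos hsum hs.le).hasSum)
  split_ifs with hj
  · rw [min_eq_left hj, min_eq_left (hst.trans hj), mul_one]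
  · rw [mul_zero, sub_nonneg]
    exact min_le_min_right _ hst

lemma le_mul_countGe (hanti : Antitone l) (hpos : ∀ j, 0 < l j) (hsum : Summable l) {s t : ℝ}
    (hs : 0 < s) (hst : s ≤ t) :
    ∑' j, min t (l j) - ∑' j, min s (l j) ≤ (t - s) * countGe l s := by
  have hl := hsum.tendsto_atTop_zero
  have h := (hasSum_ite_countGe hanti hl hs (R := ℝ)).mul_left (t - s)
  refine hasSum_le (fun j => ?_) ((summable_min hpos hsum (hs.le.trans hst)).hasSum.sub
    (summable_min hpos hsum hs.le).hasSum) h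
  split_ifs with hj
  · rw [min_eq_left hj, mul_one]
    linarith [min_le_left t (l j)]
  · rw [min_eq_right (not_le.1 hj).le, min_eq_right ((not_le.1 hj).le.trans hst)]
    simp

/-- A monotone density theorem: asymptotics of the truncated sums can be differentiated. -/
lemma tendsto_countGe_of_tendsto_tsum_min (hanti : Antitone l) (hpos : ∀ j, 0 < l j)
    (hsum : Summable l)
    (h : Tendsto (fun t => (∑' j, min t (l j)) / t ^ (1 - D)) (𝓝[>] 0) (𝓝 A)) :
    Tendsto (fun s => (countGe l s : ℝ) * s ^ D) (𝓝[>] 0) (𝓝 ((1 - D) * A)) := by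
  set f : ℝ → ℝ := fun t => ∑' j, min t (l j) with hf
  have hquot : ∀ k : ℝ, 0 < k → Tendsto (fun s => (f (k * s) - f s) / s ^ (1 - D) / (k - 1))
      (𝓝[>] 0) (𝓝 (A * ((k ^ (1 - D) - 1) / (k - 1)))) := by
    intro k hk
    have h1 := (((h.comp (tendsto_const_mul_nhdsGT_zero hk)).mul_const (k ^ (1 - D))).sub
      h).div_const (k - 1)
    have he : A * ((k ^ (1 - D) - 1) / (k - 1)) = (A * k ^ (1 - D) - A) / (k - 1) := by ring
    rw [he]
    refine h1.congr' ?_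
    filter_upwards [self_mem_nhdsWithin] with s hs
    have hs : 0 < s := hs
    have h2 := Real.rpow_pos_of_pos hs (1 - D)
    have h3 := Real.rpow_pos_of_pos hk (1 - D)
    simp only [Function.comp_apply, hf]
    rw [Real.mul_rpow hk.le hs.le]
    field_simp
  have hslope : Tendsto (fun k : ℝ => (k ^ (1 - D) - 1) / (k - 1)) (𝓝[>] 1) (𝓝 (1 - D)) := by
    have hd := (Real.hasDerivAt_rpow_const (x := 1) (p := 1 - D) (Or.inl one_ne_zero))
    rw [Real.one_rpow, mul_one] at hd
    have := (hasDerivAt_iff_tendsto_slope.1 hd).mono_left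
      (nhdsWithin_mono 1 fun x (hx : 1 < x) => hx.ne')
    refine this.congr fun k => ?_
    rw [slope_def_field, Real.one_rpow]
  have hlow : Tendsto (fun k : ℝ => A * ((k ^ (1 - D) - 1) / (k - 1))) (𝓝[>] 1)
      (𝓝 ((1 - D) * A)) := by
    simpa [mul_comm] using hslope.const_mul A
  have hup : Tendsto (fun k : ℝ => A * ((k ^ (1 - D) - 1) / (k - 1)) * k ^ D) (𝓝[>] 1)
      (𝓝 ((1 - D) * A)) := by
    have hk : Tendsto (fun k : ℝ => k ^ D) (𝓝[>] 1) (𝓝 1) := by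
      have := (Real.continuousAt_rpow_const 1 D (Or.inl one_ne_zero)).tendsto
      rw [Real.one_rpow] at this
      exact this.mono_left nhdsWithin_le_nhds
    simpa using hlow.mul hk
  have key : ∀ s : ℝ, 0 < s → s ^ (1 - D) * s ^ D = s := fun s hs => by
    rw [← Real.rpow_add hs, sub_add_cancel, Real.rpow_one]
  refine tendsto_order.2 ⟨fun a ha => ?_, fun a ha => ?_⟩
  · obtain ⟨k, hka, hk⟩ := ((hlow.eventually_const_lt ha).and self_mem_nhdsWithin).exists
    have hk : 1 < k := hk
    filter_upwards [(hquot k (by linarith)).eventually_const_lt hka, self_mem_nhdsWithin]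
      with s hs h0
    have h0 : 0 < s := h0
    refine hs.trans_le ?_
    have hle := le_mul_countGe hanti hpos hsum h0 (le_mul_of_one_le_left h0.le hk.le)
    rw [div_div, div_le_iff₀ (mul_pos (Real.rpow_pos_of_pos h0 _) (by linarith))]
    refine hle.trans_eq ?_
    linear_combination -(countGe l s * (k - 1)) * key s h0
  · obtain ⟨k, hka, hk⟩ := ((hup.eventually_lt_const ha).and self_mem_nhdsWithin).exists
    have hk : 1 < k := hk
    have hk0 : 0 < k := by linarith
    have hq := ((hquot k hk0).mul_const (k ^ D)).comp
      (tendsto_const_mul_nhdsGT_zero (inv_pos.2 hk0))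
    filter_upwards [hq.eventually_lt_const hka, self_mem_nhdsWithin] with s hs h0
    have h0 : 0 < s := h0
    refine lt_of_le_of_lt ?_ hs
    have h1 : 0 < k⁻¹ * s := by positivity
    have hks : k * (k⁻¹ * s) = s := by field_simp
    have hle := mul_countGe_le hanti hpos hsum h1 (le_mul_of_one_le_left h1.le hk.le)
    rw [hks] at hle
    simp only [Function.comp_apply]
    rw [hks, div_div, div_mul_eq_mul_div,
      le_div_iff₀ (mul_pos (Real.rpow_pos_of_pos h1 _) (by linarith))]
    have h2 : s ^ D = k ^ D * (k⁻¹ * s) ^ D := by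
      rw [← Real.mul_rpow hk0.le h1.le, hks]
    refine le_trans (le_of_eq ?_) (mul_le_mul_of_nonneg_right hle (Real.rpow_nonneg hk0.le D))
    rw [h2]
    have h3 : s - k⁻¹ * s = (k - 1) * (k⁻¹ * s) := by rw [sub_mul, hks, one_mul]
    rw [h3]
    linear_combination (countGe l s * (k - 1) * k ^ D) * key _ h1

lemma tsum_ofReal_min_eq_lintegral (hanti : Antitone l) (hl : Tendsto l atTop (𝓝 0)) (t : ℝ) :
    ∑' j, ENNReal.ofReal (min t (l j)) = ∫⁻ s in Set.Ioc 0 t, (countGe l s : ENNReal) := by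
  have h1 : ∀ s ∈ Set.Ioc 0 t, (countGe l s : ENNReal) =
      ∑' j, (Set.Iic (l j)).indicator (fun _ => (1 : ENNReal)) s := fun s hs => by
    rw [← (hasSum_ite_countGe hanti hl hs.1 (R := ENNReal)).tsum_eq]
    simp [Set.indicator_apply]
  rw [setLIntegral_congr_fun measurableSet_Ioc h1, lintegral_tsum]
  · congr 1 with j
    rw [lintegral_indicator measurableSet_Iic, setLIntegral_one,
      Measure.restrict_apply measurableSet_Iic, Set.inter_comm, Set.Ioc_inter_Iic,
      Real.volume_Ioc, sub_zero]
  · exact fun j => (measurable_const.indicator measurableSet_Iic).aemeasurable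

lemma lintegral_mul_rpow_neg (hD : D < 1) {c t : ℝ} (hc : 0 ≤ c) (ht : 0 < t) :
    ∫⁻ s in Set.Ioc 0 t, ENNReal.ofReal (c * s ^ (-D)) =
      ENNReal.ofReal (c / (1 - D) * t ^ (1 - D)) := by
  have hi : IntervalIntegrable (fun s : ℝ => c * s ^ (-D)) volume 0 t :=
    (intervalIntegral.intervalIntegrable_rpow' (by linarith)).const_mul c
  rw [← ofReal_integral_eq_lintegral_ofReal, ← intervalIntegral.integral_of_le ht.le,
    intervalIntegral.integral_const_mul, integral_rpow (Or.inl (by linarith)),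
    Real.zero_rpow (by linarith)]
  · congr 1
    rw [neg_add_eq_sub]
    ring
  · exact (intervalIntegrable_iff_integrableOn_Ioc_of_le ht.le).1 hi
  · filter_upwards [ae_restrict_mem measurableSet_Ioc] with s hs
    exact mul_nonneg hc (Real.rpow_nonneg hs.1.le _)

lemma tendsto_tsum_min_of_tendsto_countGe (hD : D < 1) (hanti : Antitone l)
    (hpos : ∀ j, 0 < l j) (hsum : Summable l) (hA : 0 < A)
    (h : Tendsto (fun s => (countGe l s : ℝ) * s ^ D) (𝓝[>] 0) (𝓝 A)) :
    Tendsto (fun t => (∑' j, min t (l j)) / t ^ (1 - D)) (𝓝[>] 0) (𝓝 (A / (1 - D))) := by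
  have hl := hsum.tendsto_atTop_zero
  have hD' : 0 < 1 - D := by linarith
  have hf : ∀ t : ℝ, 0 < t → ENNReal.ofReal (∑' j, min t (l j)) =
      ∫⁻ s in Set.Ioc 0 t, (countGe l s : ENNReal) := fun t ht => by
    rw [ENNReal.ofReal_tsum_of_nonneg (fun j => le_min ht.le (hpos j).le)
      (summable_min hpos hsum ht.le), tsum_ofReal_min_eq_lintegral hanti hl t]
  have hmul : ∀ (c s : ℝ), 0 < s → c * s ^ (-D) * s ^ D = c := fun c s hs => by
    rw [mul_assoc, ← Real.rpow_add hs, neg_add_cancel, Real.rpow_zero, mul_one]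
  refine tendsto_order.2 ⟨fun a ha => ?_, fun a ha => ?_⟩
  · rw [lt_div_iff₀ hD'] at ha
    obtain ⟨c, hc1, hc2⟩ := exists_between (max_lt ha hA)
    have hc0 : 0 < c := (le_max_right _ _).trans_lt hc1
    have hca : a * (1 - D) < c := (le_max_left _ _).trans_lt hc1
    obtain ⟨u, hu, hsub⟩ := mem_nhdsGT_iff_exists_Ioo_subset.1 (h.eventually_const_lt hc2)
    filter_upwards [Ioo_mem_nhdsGT hu] with t ht
    have htp := Real.rpow_pos_of_pos ht.1 (1 - D)
    have hle : ENNReal.ofReal (c / (1 - D) * t ^ (1 - D)) ≤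
        ENNReal.ofReal (∑' j, min t (l j)) := by
      rw [hf t ht.1, ← lintegral_mul_rpow_neg hD hc0.le ht.1]
      refine setLIntegral_mono' measurableSet_Ioc fun s hs => ?_
      rw [← ENNReal.ofReal_natCast]
      refine ENNReal.ofReal_le_ofReal ?_
      have h1 : c < countGe l s * s ^ D := hsub ⟨hs.1, hs.2.trans_lt ht.2⟩
      refine le_of_mul_le_mul_right ?_ (Real.rpow_pos_of_pos hs.1 D)
      rw [hmul c s hs.1]
      exact h1.le
    rw [ENNReal.ofReal_le_ofReal_iff (tsum_nonneg fun j => le_min ht.1.le (hpos j).le)] at hle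
    rw [lt_div_iff₀ htp]
    refine lt_of_lt_of_le (mul_lt_mul_of_pos_right ?_ htp) hle
    rwa [lt_div_iff₀ hD']
  · rw [gt_iff_lt, div_lt_iff₀ hD'] at ha
    obtain ⟨c, hc1, hc2⟩ := exists_between ha
    have hc0 : 0 < c := hA.trans hc1
    obtain ⟨u, hu, hsub⟩ := mem_nhdsGT_iff_exists_Ioo_subset.1 (h.eventually_lt_const hc1)
    filter_upwards [Ioo_mem_nhdsGT hu] with t ht
    have htp := Real.rpow_pos_of_pos ht.1 (1 - D)
    have hle : ENNReal.ofReal (∑' j, min t (l j)) ≤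
        ENNReal.ofReal (c / (1 - D) * t ^ (1 - D)) := by
      rw [hf t ht.1, ← lintegral_mul_rpow_neg hD hc0.le ht.1]
      refine setLIntegral_mono' measurableSet_Ioc fun s hs => ?_
      rw [← ENNReal.ofReal_natCast]
      refine ENNReal.ofReal_le_ofReal ?_
      have h1 : countGe l s * s ^ D < c := hsub ⟨hs.1, hs.2.trans_lt ht.2⟩
      refine le_of_mul_le_mul_right ?_ (Real.rpow_pos_of_pos hs.1 D)
      rw [hmul c s hs.1]
      exact h1.le
    rw [ENNReal.ofReal_le_ofReal_iff (by positivity)] at hle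
    rw [div_lt_iff₀ htp]
    refine hle.trans_lt (mul_lt_mul_of_pos_right ?_ htp)
    rwa [div_lt_iff₀ hD']

end Sequences

variable (S : FractalString)

lemma l_pos (j : ℕ) : 0 < S.l j := sub_pos.2 (S.lt j)

lemma l_antitone : Antitone S.l := S.anti

lemma summable_l : Summable S.l := by
  have h : volume (⋃ j, Set.Ioo (S.a j) (S.b j)) = ∑' j, ENNReal.ofReal (S.l j) := by
    rw [measure_iUnion S.disj fun j => measurableSet_Ioo]
    simp [l]
  have hfin : ∑' j, ENNReal.ofReal (S.l j) ≠ ⊤ := h ▸ S.bdd.measure_lt_top.ne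
  exact (ENNReal.summable_toReal hfin).congr fun j => ENNReal.toReal_ofReal (S.l_pos j).le

lemma isOpen_Omega : IsOpen S.Omega := isOpen_iUnion fun _ => isOpen_Ioo

lemma Ioo_subset_Omega (j : ℕ) : Set.Ioo (S.a j) (S.b j) ⊆ S.Omega :=
  Set.subset_iUnion (fun j => Set.Ioo (S.a j) (S.b j)) j

lemma a_notMem_Omega (j : ℕ) : S.a j ∉ S.Omega := by
  intro h
  obtain ⟨i, hi⟩ := Set.mem_iUnion.1 h
  have hij : i ≠ j := by
    rintro rfl
    exact lt_irrefl _ hi.1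
  obtain ⟨y, hy1, hy2⟩ := exists_between (lt_min (S.lt j) hi.2)
  exact Set.disjoint_left.1 (S.disj hij) ⟨hi.1.trans hy1, hy2.trans_le (min_le_right _ _)⟩
    ⟨hy1, hy2.trans_le (min_le_left _ _)⟩

lemma b_notMem_Omega (j : ℕ) : S.b j ∉ S.Omega := by
  intro h
  obtain ⟨i, hi⟩ := Set.mem_iUnion.1 h
  have hij : i ≠ j := by
    rintro rfl
    exact lt_irrefl _ hi.2
  obtain ⟨y, hy1, hy2⟩ := exists_between (max_lt (S.lt j) hi.1)
  exact Set.disjoint_left.1 (S.disj hij) ⟨(le_max_right _ _).trans_lt hy1, hy2.trans hi.2⟩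
    ⟨(le_max_left _ _).trans_lt hy1, hy2⟩

lemma Icc_subset_closure_Omega (j : ℕ) : Set.Icc (S.a j) (S.b j) ⊆ closure S.Omega := by
  rw [← closure_Ioo (S.lt j).ne]
  exact closure_mono (S.Ioo_subset_Omega j)

lemma infDist_frontier_lt_iff {j : ℕ} {x ε : ℝ} (hx : x ∈ Set.Ioo (S.a j) (S.b j)) :
    Metric.infDist x (frontier S.Omega) < ε ↔ x < S.a j + ε ∨ S.b j - ε < x := by
  have ha : S.a j ∈ frontier S.Omega := by
    rw [S.isOpen_Omega.frontier_eq]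
    exact ⟨S.Icc_subset_closure_Omega j ⟨le_rfl, (S.lt j).le⟩, S.a_notMem_Omega j⟩
  have hb : S.b j ∈ frontier S.Omega := by
    rw [S.isOpen_Omega.frontier_eq]
    exact ⟨S.Icc_subset_closure_Omega j ⟨(S.lt j).le, le_rfl⟩, S.b_notMem_Omega j⟩
  rw [Metric.infDist_lt_iff ⟨_, ha⟩]
  constructor
  · rintro ⟨y, hy, hxy⟩
    rw [S.isOpen_Omega.frontier_eq] at hy
    rw [Real.dist_eq, abs_lt] at hxy
    by_cases hya : y ≤ S.a j
    · left
      linarith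
    · right
      have : S.b j ≤ y := by
        by_contra! hyb
        exact hy.2 (S.Ioo_subset_Omega j ⟨not_le.1 hya, hyb⟩)
      linarith
  · rintro (h | h)
    · refine ⟨_, ha, ?_⟩
      rw [Real.dist_eq, abs_of_pos (sub_pos.2 hx.1)]
      linarith
    · refine ⟨_, hb, ?_⟩
      rw [Real.dist_eq, abs_of_neg (sub_neg.2 hx.2)]
      linarith

lemma volume_innerNbhd {ε : ℝ} (hε : 0 < ε) :
    (volume (S.innerNbhd ε)).toReal = ∑' j, min (2 * ε) (S.l j) := by
  have hU : S.innerNbhd ε =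
      ⋃ j, Set.Ioo (S.a j) (S.b j) \ Set.Icc (S.a j + ε) (S.b j - ε) := by
    ext x
    simp only [innerNbhd, Set.mem_ofPred_eq, Set.mem_iUnion, Set.mem_sdiff]
    have key : ∀ j, x ∈ Set.Ioo (S.a j) (S.b j) → (Metric.infDist x (frontier S.Omega) < ε ↔
        x ∉ Set.Icc (S.a j + ε) (S.b j - ε)) := fun j hj => by
      rw [S.infDist_frontier_lt_iff hj, Set.mem_Icc, not_and_or, not_le, not_le]
    constructor
    · rintro ⟨hx, hd⟩
      obtain ⟨j, hj⟩ := Set.mem_iUnion.1 hx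
      exact ⟨j, hj, (key j hj).1 hd⟩
    · rintro ⟨j, hj, hd⟩
      exact ⟨S.Ioo_subset_Omega j hj, (key j hj).2 hd⟩
  have hm : ∀ j, volume (Set.Ioo (S.a j) (S.b j) \ Set.Icc (S.a j + ε) (S.b j - ε)) =
      ENNReal.ofReal (min (2 * ε) (S.l j)) := fun j => by
    have hsub : Set.Icc (S.a j + ε) (S.b j - ε) ⊆ Set.Ioo (S.a j) (S.b j) :=
      fun x hx => ⟨by linarith [hx.1], by linarith [hx.2]⟩
    rw [measure_sdiff hsub
      measurableSet_Icc.nullMeasurableSet (by simp), Real.volume_Ioo, Real.volume_Icc]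
    by_cases h : 2 * ε ≤ S.l j
    · rw [min_eq_left h]
      unfold l at h
      rw [← ENNReal.ofReal_sub _ (by linarith)]
      congr 1
      ring
    · rw [min_eq_right (not_le.1 h).le]
      unfold l at h ⊢
      rw [ENNReal.ofReal_of_nonpos (p := S.b j - ε - (S.a j + ε)) (by linarith), tsub_zero]
  rw [hU, measure_iUnion _ fun j => measurableSet_Ioo.diff measurableSet_Icc]
  · simp_rw [hm]
    have hnn : ∀ j, 0 ≤ min (2 * ε) (S.l j) := fun j => le_min (by linarith) (S.l_pos j).le
    rw [← ENNReal.ofReal_tsum_of_nonneg hnn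
      (summable_min S.l_pos S.summable_l (by linarith)), ENNReal.toReal_ofReal (tsum_nonneg hnn)]
  · exact fun i j hij => (S.disj hij).mono Set.sdiff_subset Set.sdiff_subset

lemma minkTendsto_iff {D M : ℝ} :
    S.MinkTendsto D M ↔
      Tendsto (fun t => (∑' j, min t (S.l j)) / t ^ (1 - D)) (𝓝[>] 0)
        (𝓝 (M / 2 ^ (1 - D))) := by
  have h2 : (0 : ℝ) < 2 ^ (1 - D) := by positivity
  have heq : ∀ ε : ℝ, 0 < ε → (volume (S.innerNbhd ε)).toReal / ε ^ (1 - D) =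
      (∑' j, min (2 * ε) (S.l j)) / (2 * ε) ^ (1 - D) * 2 ^ (1 - D) := fun ε hε => by
    have := Real.rpow_pos_of_pos hε (1 - D)
    rw [S.volume_innerNbhd hε, Real.mul_rpow zero_le_two hε.le]
    field_simp
  constructor
  · intro h
    have hhalf := tendsto_const_mul_nhdsGT_zero (by norm_num : (0 : ℝ) < 2⁻¹)
    refine ((h.comp hhalf).div_const (2 ^ (1 - D))).congr' ?_
    filter_upwards [self_mem_nhdsWithin] with t ht
    have ht : 0 < t := ht
    simp only [Function.comp_apply]
    rw [heq _ (by positivity), mul_inv_cancel_left₀ two_ne_zero, mul_div_cancel_right₀ _ h2.ne']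
  · intro h
    have h' := (h.comp (tendsto_const_mul_nhdsGT_zero zero_lt_two)).mul_const (2 ^ (1 - D))
    rw [div_mul_cancel₀ _ h2.ne'] at h'
    refine h'.congr' ?_
    filter_upwards [self_mem_nhdsWithin] with ε hε
    exact (heq ε hε).symm

lemma tendsto_NL_iff {D A : ℝ} :
    Tendsto (fun x : ℝ => (S.NL x : ℝ) / x ^ D) atTop (𝓝 A) ↔
      Tendsto (fun s => (countGe S.l s : ℝ) * s ^ D) (𝓝[>] 0) (𝓝 A) := by
  have hNL : ∀ x : ℝ, 0 < x → (S.NL x : ℝ) / x ^ D = (countGe S.l x⁻¹ : ℝ) * x⁻¹ ^ D :=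
    fun x hx => by
      rw [Real.inv_rpow hx.le, ← div_eq_mul_inv, NL, countGe, one_div]
  constructor
  · intro h
    refine (h.comp tendsto_inv_nhdsGT_zero).congr' ?_
    filter_upwards [self_mem_nhdsWithin] with s hs
    have hs : 0 < s := hs
    simp only [Function.comp_apply]
    rw [hNL _ (inv_pos.2 hs), inv_inv]
  · intro h
    refine (h.comp tendsto_inv_atTop_nhdsGT_zero).congr' ?_
    filter_upwards [eventually_gt_atTop 0] with x hx
    exact (hNL x hx).symm

lemma tendsto_l_iff_tendsto_countGe {D L : ℝ} (hD : 0 < D) (hL : 0 < L) :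
    Tendsto (fun j : ℕ => S.l j * (j : ℝ) ^ (1 / D)) atTop (𝓝 L) ↔
      Tendsto (fun s => (countGe S.l s : ℝ) * s ^ D) (𝓝[>] 0) (𝓝 (L ^ D)) := by
  rw [tendsto_mul_rpow_inv_iff hD S.l_pos hL]
  exact ⟨tendsto_countGe_of_tendsto hD S.l_antitone S.l_pos S.summable_l.tendsto_atTop_zero,
    tendsto_of_tendsto_countGe S.l_antitone S.l_pos S.summable_l.tendsto_atTop_zero⟩

end FractalString

/-- Minkowski measurability criterion (Lapidus–Pomerance): for `D ∈ (0,1)`, an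
ordinary fractal string is Minkowski measurable of dimension `D` iff
`l_j · j^{1/D} → L` for some `L ∈ (0,∞)`, in which case the Minkowski content
is `M = 2^{1-D} L^D / (1-D)`; moreover this holds iff `N_L(x)/x^D → L^D`. -/
theorem minkowskiMeasurable_criterion (D : ℝ) (hD : D ∈ Set.Ioo (0 : ℝ) 1)
    (S : FractalString) :
    (S.MinkowskiMeasurable D ↔
      ∃ L : ℝ, 0 < L ∧
        Tendsto (fun j : ℕ => S.l j * (j : ℝ) ^ (1 / D)) atTop (𝓝 L)) ∧
    (∀ L : ℝ, 0 < L →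
      Tendsto (fun j : ℕ => S.l j * (j : ℝ) ^ (1 / D)) atTop (𝓝 L) →
        S.MinkTendsto D ((2 : ℝ) ^ (1 - D) * L ^ D / (1 - D))) ∧
    (∀ L : ℝ, 0 < L →
      (Tendsto (fun j : ℕ => S.l j * (j : ℝ) ^ (1 / D)) atTop (𝓝 L) ↔
        Tendsto (fun x : ℝ => (S.NL x : ℝ) / x ^ D) atTop (𝓝 (L ^ D)))) := by
  have hD1 : 0 < 1 - D := sub_pos.2 hD.2
  have h2 : (0 : ℝ) < 2 ^ (1 - D) := by positivity
  have content : ∀ L : ℝ, 0 < L →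
      Tendsto (fun j : ℕ => S.l j * (j : ℝ) ^ (1 / D)) atTop (𝓝 L) →
        S.MinkTendsto D ((2 : ℝ) ^ (1 - D) * L ^ D / (1 - D)) := by
    intro L hL h
    rw [S.tendsto_l_iff_tendsto_countGe hD.1 hL] at h
    rw [S.minkTendsto_iff, mul_div_assoc, mul_div_cancel_left₀ _ h2.ne']
    exact FractalString.tendsto_tsum_min_of_tendsto_countGe hD.2 S.l_antitone S.l_pos
      S.summable_l (Real.rpow_pos_of_pos hL D) h
  refine ⟨⟨?_, ?_⟩, content, fun L hL => ?_⟩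
  · rintro ⟨M, hM, h⟩
    have hA : 0 < (1 - D) * (M / 2 ^ (1 - D)) := by positivity
    refine ⟨((1 - D) * (M / 2 ^ (1 - D))) ^ (1 / D), Real.rpow_pos_of_pos hA _, ?_⟩
    rw [S.tendsto_l_iff_tendsto_countGe hD.1 (Real.rpow_pos_of_pos hA _), ← Real.rpow_mul hA.le,
      one_div_mul_cancel hD.1.ne', Real.rpow_one]
    exact FractalString.tendsto_countGe_of_tendsto_tsum_min S.l_antitone S.l_pos S.summable_l
      (S.minkTendsto_iff.1 h)
  · rintro ⟨L, hL, h⟩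
    have := Real.rpow_pos_of_pos hL D
    exact ⟨_, by positivity, content L hL h⟩
  · rw [S.tendsto_l_iff_tendsto_countGe hD.1 hL, S.tendsto_NL_iff]
end
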